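/- Let 1 ≤ p ≤ q. Then for θ ∈ [0,1) the Assouad spectrum of S_{p,q} is given by: dim_A^θ S_{p,q} = (p − θ(p−1))/(p(1−θ)) if 0 ≤ θ < p/(1+q); dim_A^θ S_{p,q} = (2+q−θ(1+q))/((1+q)(1−θ)) if p/(1+q) ≤ θ < q/(1+q); and dim_A^θ S_{p,q} = 2 if q/(1+q) ≤ θ < 1. -/

import Mathlib

open Set Metric MeasureTheory

noncomputable def spiral (p q : ℝ) : Set ℂ :=
  {z : ℂ | ∃ t : ℝ, 1 < t ∧
    z = (t ^ (-p) * Real.cos t : ℝ) + (t ^ (-q) * Real.sin t : ℝ) * Complex.I}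

/-- An axes-oriented closed square of sidelength `r` with bottom-left corner `c`. -/
def closedSquare (c : ℝ × ℝ) (r : ℝ) : Set ℂ :=
  {z : ℂ | z.re ∈ Set.Icc c.1 (c.1 + r) ∧ z.im ∈ Set.Icc c.2 (c.2 + r)}

/-- The smallest number of squares of sidelength `r` needed to cover `E`. -/
noncomputable def sqCoverNum (E : Set ℂ) (r : ℝ) : ℕ :=
  sInf {n : ℕ | ∃ c : Fin n → ℝ × ℝ, E ⊆ ⋃ i, closedSquare (c i) r}

/-- The Assouad spectrum of `F ⊆ ℂ` at `θ`. -/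
noncomputable def assouadSpectrum (θ : ℝ) (F : Set ℂ) : ℝ :=
  sInf {α : ℝ | 0 ≤ α ∧ ∃ C : ℝ, 0 < C ∧ ∀ r : ℝ, 0 < r → r < 1 → ∀ x ∈ F,
    (sqCoverNum (Metric.ball x (r ^ θ) ∩ F) r : ℝ) ≤ C * (r ^ θ / r) ^ α}

/-- `E` can be covered by at most `n` axes-oriented closed squares of sidelength `r`. -/
def IsCoverableBy (E : Set ℂ) (r n : ℝ) : Prop :=
  ∃ s : Finset (ℝ × ℝ), (s.card : ℝ) ≤ n ∧ E ⊆ ⋃ c ∈ s, closedSquare c r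

namespace IsCoverableBy

lemma exists_fin {E : Set ℂ} {r n : ℝ} (h : IsCoverableBy E r n) :
    ∃ m : ℕ, (m : ℝ) ≤ n ∧ ∃ c : Fin m → ℝ × ℝ, E ⊆ ⋃ i, closedSquare (c i) r := by
  obtain ⟨s, hs, hE⟩ := h
  refine ⟨s.card, hs, fun i => (s.equivFin.symm i : ℝ × ℝ), fun z hz => ?_⟩
  obtain ⟨c, hc, hzc⟩ := mem_iUnion₂.1 (hE hz)
  exact mem_iUnion.2 ⟨s.equivFin ⟨c, hc⟩, by simpa using hzc⟩

lemma sqCoverNum_le {E : Set ℂ} {r n : ℝ} (h : IsCoverableBy E r n) :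
    (sqCoverNum E r : ℝ) ≤ n := by
  obtain ⟨m, hm, hc⟩ := h.exists_fin
  exact le_trans (by exact_mod_cast Nat.sInf_le hc) hm

lemma mono {E E' : Set ℂ} {r n n' : ℝ} (h : IsCoverableBy E r n) (hE : E' ⊆ E) (hn : n ≤ n') :
    IsCoverableBy E' r n' := by
  obtain ⟨s, hs, hsE⟩ := h
  exact ⟨s, hs.trans hn, hE.trans hsE⟩

lemma union {E E' : Set ℂ} {r n n' : ℝ} (h : IsCoverableBy E r n) (h' : IsCoverableBy E' r n') :
    IsCoverableBy (E ∪ E') r (n + n') := by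
  classical
  obtain ⟨s, hs, hsE⟩ := h
  obtain ⟨s', hs', hsE'⟩ := h'
  refine ⟨s ∪ s', ?_, ?_⟩
  · have : ((s ∪ s').card : ℝ) ≤ s.card + s'.card := by exact_mod_cast Finset.card_union_le s s'
    linarith
  · rw [Finset.set_biUnion_union]
    exact union_subset_union hsE hsE'

lemma biUnion {ι : Type*} (T : Finset ι) {E : ι → Set ℂ} {r : ℝ} {n : ι → ℝ}
    (h : ∀ i ∈ T, IsCoverableBy (E i) r (n i)) :
    IsCoverableBy (⋃ i ∈ T, E i) r (∑ i ∈ T, n i) := by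
  classical
  induction T using Finset.induction_on with
  | empty => exact ⟨∅, by simp, by simp⟩
  | insert a T ha ih =>
    rw [Finset.set_biUnion_insert, Finset.sum_insert ha]
    exact (h a (Finset.mem_insert_self a T)).union
      (ih fun i hi => h i (Finset.mem_insert_of_mem hi))

lemma of_labels {α ι : Type*} (g : α → ℂ) (A : Set α) {r : ℝ} (T : Finset ι) (f : α → ι)
    (hf : ∀ x ∈ A, f x ∈ T)
    (hosc : ∀ x ∈ A, ∀ y ∈ A, f x = f y →
      |(g x).re - (g y).re| ≤ r ∧ |(g x).im - (g y).im| ≤ r) :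
    IsCoverableBy (g '' A) r T.card := by
  classical
  refine ⟨T.image fun i => (sInf ((fun x => (g x).re) '' {x ∈ A | f x = i}),
    sInf ((fun x => (g x).im) '' {x ∈ A | f x = i})), by exact_mod_cast Finset.card_image_le, ?_⟩
  rintro _ ⟨x, hx, rfl⟩
  refine mem_iUnion₂.2 ⟨_, Finset.mem_image_of_mem _ (hf x hx), ?_⟩
  have key : ∀ h : α → ℝ, (∀ y ∈ A, f y = f x → |h y - h x| ≤ r) →
      h x ∈ Icc (sInf (h '' {y ∈ A | f y = f x})) (sInf (h '' {y ∈ A | f y = f x}) + r) := by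
    intro h hh
    have hlow : ∀ v ∈ h '' {y ∈ A | f y = f x}, h x - r ≤ v := by
      rintro _ ⟨y, ⟨hy, hyx⟩, rfl⟩
      linarith [(abs_le.1 (hh y hy hyx)).1]
    have hmem : h x ∈ h '' {y ∈ A | f y = f x} := ⟨x, ⟨hx, rfl⟩, rfl⟩
    exact ⟨csInf_le ⟨_, hlow⟩ hmem, by linarith [le_csInf ⟨_, hmem⟩ hlow]⟩
  exact ⟨key (fun y => (g y).re) fun y hy hyx => (hosc y hy x hx hyx).1,
    key (fun y => (g y).im) fun y hy hyx => (hosc y hy x hx hyx).2⟩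

end IsCoverableBy

lemma abs_sub_le_of_floor_eq {r a u v : ℝ} (hr : 0 < r) (hu : a ≤ u) (hv : a ≤ v)
    (h : ⌊(u - a) / r⌋₊ = ⌊(v - a) / r⌋₊) : |u - v| ≤ r := by
  have hu1 := Nat.floor_le (div_nonneg (sub_nonneg.2 hu) hr.le)
  have hv1 := Nat.floor_le (div_nonneg (sub_nonneg.2 hv) hr.le)
  have hu2 := Nat.lt_floor_add_one ((u - a) / r)
  have hv2 := Nat.lt_floor_add_one ((v - a) / r)
  rw [h] at hu1 hu2
  rw [le_div_iff₀ hr] at hu1 hv1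
  rw [div_lt_iff₀ hr] at hu2 hv2
  rw [abs_le]
  constructor <;> nlinarith

lemma floor_mem_range {r a w u : ℝ} (hr : 0 < r) (hu : u ≤ a + w) :
    ⌊(u - a) / r⌋₊ ∈ Finset.range (⌊w / r⌋₊ + 1) := by
  rw [Finset.mem_range, Nat.lt_succ_iff]
  exact Nat.floor_le_floor (by gcongr; linarith)

lemma card_range_floor_le {w r : ℝ} (hr : 0 < r) (hw : 0 ≤ w) :
    ((Finset.range (⌊w / r⌋₊ + 1)).card : ℝ) ≤ w / r + 1 := by
  rw [Finset.card_range]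
  push_cast
  linarith [Nat.floor_le (div_nonneg hw hr.le)]

namespace IsCoverableBy

lemma of_control {α : Type*} (g : α → ℂ) (A : Set α) (u : α → ℝ) {r a w : ℝ} (hr : 0 < r)
    (hw : 0 ≤ w) (hu : ∀ x ∈ A, u x ∈ Icc a (a + w))
    (h : ∀ x ∈ A, ∀ y ∈ A,
      |(g x).re - (g y).re| ≤ |u x - u y| ∧ |(g x).im - (g y).im| ≤ |u x - u y|) :
    IsCoverableBy (g '' A) r (w / r + 1) := by
  refine (of_labels g A (Finset.range (⌊w / r⌋₊ + 1)) (fun x => ⌊(u x - a) / r⌋₊)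
    (fun x hx => floor_mem_range hr (hu x hx).2) fun x hx y hy hxy => ?_).mono Subset.rfl
    (card_range_floor_le hr hw)
  have := abs_sub_le_of_floor_eq hr (hu x hx).1 (hu y hy).1 hxy
  exact ⟨(h x hx y hy).1.trans this, (h x hx y hy).2.trans this⟩

lemma of_box {E : Set ℂ} {r a b w h : ℝ} (hr : 0 < r) (hw : 0 ≤ w) (hh : 0 ≤ h)
    (hre : ∀ z ∈ E, |z.re - a| ≤ w) (him : ∀ z ∈ E, |z.im - b| ≤ h) :
    IsCoverableBy E r ((2 * w / r + 1) * (2 * h / r + 1)) := by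
  have hre' : ∀ z ∈ E, a - w ≤ z.re ∧ z.re ≤ a - w + 2 * w := fun z hz => by
    have := abs_le.1 (hre z hz); constructor <;> linarith
  have him' : ∀ z ∈ E, b - h ≤ z.im ∧ z.im ≤ b - h + 2 * h := fun z hz => by
    have := abs_le.1 (him z hz); constructor <;> linarith
  have := of_labels id E (r := r)
    (Finset.range (⌊2 * w / r⌋₊ + 1) ×ˢ Finset.range (⌊2 * h / r⌋₊ + 1))
    (fun z => (⌊(z.re - (a - w)) / r⌋₊, ⌊(z.im - (b - h)) / r⌋₊))
    (fun z hz => Finset.mem_product.2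
      ⟨floor_mem_range hr (hre' z hz).2, floor_mem_range hr (him' z hz).2⟩)
    (fun z hz z' hz' hzz => by
      rw [Prod.mk.injEq] at hzz
      exact ⟨abs_sub_le_of_floor_eq hr (hre' z hz).1 (hre' z' hz').1 hzz.1,
        abs_sub_le_of_floor_eq hr (him' z hz).1 (him' z' hz').1 hzz.2⟩)
  rw [image_id] at this
  refine this.mono Subset.rfl ?_
  rw [Finset.card_product]
  rw [Nat.cast_mul]
  exact mul_le_mul (card_range_floor_le hr (by positivity))
    (card_range_floor_le hr (by positivity)) (by positivity) (by positivity)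

/-- A set on which both coordinates are monotone functions of a real parameter is essentially
one-dimensional. -/
lemma of_monotone_coordinates (g : ℝ → ℂ) (A : Set ℝ) {r a b ρ : ℝ} (hr : 0 < r) (hρ : 0 ≤ ρ)
    (hre : ∀ t ∈ A, |(g t).re - a| ≤ ρ) (him : ∀ t ∈ A, |(g t).im - b| ≤ ρ)
    (hx : MonotoneOn (fun t => (g t).re) A ∨ AntitoneOn (fun t => (g t).re) A)
    (hy : MonotoneOn (fun t => (g t).im) A ∨ AntitoneOn (fun t => (g t).im) A) :
    IsCoverableBy (g '' A) r (4 * ρ / r + 1) := by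
  have hsign : (∀ s ∈ A, ∀ t ∈ A, 0 ≤ ((g s).re - (g t).re) * ((g s).im - (g t).im)) ∨
      (∀ s ∈ A, ∀ t ∈ A, ((g s).re - (g t).re) * ((g s).im - (g t).im) ≤ 0) := by
    rcases hx with hx | hx <;> rcases hy with hy | hy
    · refine Or.inl fun s hs t ht => ?_
      rcases le_total s t with hst | hst
      · exact mul_nonneg_of_nonpos_of_nonpos (sub_nonpos.2 (hx hs ht hst))
          (sub_nonpos.2 (hy hs ht hst))
      · exact mul_nonneg (sub_nonneg.2 (hx ht hs hst)) (sub_nonneg.2 (hy ht hs hst))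
    · refine Or.inr fun s hs t ht => ?_
      rcases le_total s t with hst | hst
      · exact mul_nonpos_of_nonpos_of_nonneg (sub_nonpos.2 (hx hs ht hst))
          (sub_nonneg.2 (hy hs ht hst))
      · exact mul_nonpos_of_nonneg_of_nonpos (sub_nonneg.2 (hx ht hs hst))
          (sub_nonpos.2 (hy ht hs hst))
    · refine Or.inr fun s hs t ht => ?_
      rcases le_total s t with hst | hst
      · exact mul_nonpos_of_nonneg_of_nonpos (sub_nonneg.2 (hx hs ht hst))
          (sub_nonpos.2 (hy hs ht hst))
      · exact mul_nonpos_of_nonpos_of_nonneg (sub_nonpos.2 (hx ht hs hst))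
          (sub_nonneg.2 (hy ht hs hst))
    · refine Or.inl fun s hs t ht => ?_
      rcases le_total s t with hst | hst
      · exact mul_nonneg (sub_nonneg.2 (hx hs ht hst)) (sub_nonneg.2 (hy hs ht hst))
      · exact mul_nonneg_of_nonpos_of_nonpos (sub_nonpos.2 (hx ht hs hst))
          (sub_nonpos.2 (hy ht hs hst))
  rcases hsign with hs | hs
  · refine of_control g A (fun t => (g t).re + (g t).im) (a := a + b - 2 * ρ) hr (by positivity)
      (fun t ht => ?_) fun s hsA t ht => ?_
    · have h1 := abs_le.1 (hre t ht)
      have h2 := abs_le.1 (him t ht)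
      constructor <;> linarith
    · have := hs s hsA t ht
      constructor <;> refine sq_le_sq.1 ?_ <;> nlinarith [sq_nonneg ((g s).re - (g t).re),
        sq_nonneg ((g s).im - (g t).im)]
  · refine of_control g A (fun t => (g t).re - (g t).im) (a := a - b - 2 * ρ) hr (by positivity)
      (fun t ht => ?_) fun s hsA t ht => ?_
    · have h1 := abs_le.1 (hre t ht)
      have h2 := abs_le.1 (him t ht)
      constructor <;> linarith
    · have := hs s hsA t ht
      constructor <;> refine sq_le_sq.1 ?_ <;> nlinarith [sq_nonneg ((g s).re - (g t).re),
        sq_nonneg ((g s).im - (g t).im)]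

end IsCoverableBy

lemma le_sqCoverNum_of_separated {E : Set ℂ} {r : ℝ} {ι : Type*} [Fintype ι]
    (hE : ∃ n : ℝ, IsCoverableBy E r n) (f : ι → ℂ) (hf : ∀ i, f i ∈ E)
    (hsep : ∀ i j, i ≠ j → r < |(f i).re - (f j).re| ∨ r < |(f i).im - (f j).im|) :
    Fintype.card ι ≤ sqCoverNum E r := by
  obtain ⟨n, hn⟩ := hE
  obtain ⟨m, -, hm⟩ := hn.exists_fin
  obtain ⟨c, hc⟩ := Nat.sInf_mem (s := {n : ℕ | ∃ c : Fin n → ℝ × ℝ,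
    E ⊆ ⋃ i, closedSquare (c i) r}) ⟨m, hm⟩
  choose k hk using fun i => mem_iUnion.1 (hc (hf i))
  have hinj : Function.Injective k := by
    intro i j hij
    by_contra hne
    have h1 := hk i
    have h2 := hk j
    rw [← hij] at h2
    obtain ⟨⟨a1, a2⟩, b1, b2⟩ := h1
    obtain ⟨⟨a3, a4⟩, b3, b4⟩ := h2
    rcases hsep i j hne with h | h
    · exact absurd h (not_lt.2 (abs_le.2 ⟨by linarith, by linarith⟩))
    · exact absurd h (not_lt.2 (abs_le.2 ⟨by linarith, by linarith⟩))
  simpa [sqCoverNum] using Fintype.card_le_of_injective k hinj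

/-- The parametrisation of the elliptical polynomial spiral. -/
noncomputable def spiralPoint (p q t : ℝ) : ℂ := ⟨t ^ (-p) * Real.cos t, t ^ (-q) * Real.sin t⟩

lemma mem_spiral_iff {p q : ℝ} {z : ℂ} :
    z ∈ spiral p q ↔ ∃ t : ℝ, 1 < t ∧ z = spiralPoint p q t := by
  refine exists_congr fun t => and_congr_right fun _ => ?_
  have : ((t ^ (-p) * Real.cos t : ℝ) : ℂ) + ((t ^ (-q) * Real.sin t : ℝ) : ℂ) * Complex.I
      = spiralPoint p q t := by
    apply Complex.ext <;> simp only [Complex.add_re, Complex.add_im, Complex.ofReal_re,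
      Complex.ofReal_im, Complex.re_ofReal_mul, Complex.im_ofReal_mul, Complex.I_re, Complex.I_im,
      spiralPoint] <;> ring
  rw [this]

/-- A function whose derivative is a nonnegative multiple of `sin ∘ ψ`, with `ψ` monotone, is
monotone or antitone where `ψ` stays between consecutive multiples of `Real.pi`. -/
lemma monotoneOn_or_antitoneOn_of_deriv_eq_mul_sin {f h ψ : ℝ → ℝ}
    (hf : ∀ t, 0 < t → HasDerivAt f (h t * Real.sin (ψ t)) t) (hh : ∀ t, 0 < t → 0 ≤ h t)
    (hψ : MonotoneOn ψ (Ioi 0)) (i : ℤ) {A : Set ℝ} (hA : ∀ t ∈ A, 0 < t ∧ ⌊ψ t / Real.pi⌋ = i) :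
    MonotoneOn f A ∨ AntitoneOn f A := by
  have hsin : ∀ s ∈ A, ∀ t ∈ A, ∀ v ∈ Icc s t, 0 ≤ Real.sin (ψ v - i * Real.pi) := by
    intro s hs t ht v hv
    obtain ⟨hs0, hsi⟩ := hA s hs
    obtain ⟨ht0, hti⟩ := hA t ht
    have hv0 : 0 < v := hs0.trans_le hv.1
    have h1 := hψ hs0 hv0 hv.1
    have h2 := hψ hv0 ht0 hv.2
    have h3 := Int.floor_le (ψ s / Real.pi)
    have h4 := Int.lt_floor_add_one (ψ t / Real.pi)
    rw [hsi, le_div_iff₀ Real.pi_pos] at h3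
    rw [hti, div_lt_iff₀ Real.pi_pos] at h4
    exact Real.sin_nonneg_of_nonneg_of_le_pi (by linarith) (by linarith)
  simp_rw [Real.sin_sub_int_mul_pi] at hsin
  have hcont : ∀ s ∈ A, ∀ t, ContinuousOn f (Icc s t) := fun s hs t v hv =>
    (hf v ((hA s hs).1.trans_le hv.1)).continuousAt.continuousWithinAt
  rcases Int.even_or_odd i with hi | hi
  · left
    intro s hs t ht hst
    have hderiv : ∀ v ∈ interior (Icc s t), HasDerivWithinAt f (h v * Real.sin (ψ v))
        (interior (Icc s t)) v := fun v hv =>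
      (hf v ((hA s hs).1.trans_le (interior_subset hv).1)).hasDerivWithinAt
    refine monotoneOn_of_hasDerivWithinAt_nonneg (convex_Icc s t) (hcont s hs t) hderiv
      (fun v hv => ?_) (left_mem_Icc.2 hst) (right_mem_Icc.2 hst) hst
    have := hsin s hs t ht v (interior_subset hv)
    rw [hi.neg_one_zpow, one_mul] at this
    exact mul_nonneg (hh v ((hA s hs).1.trans_le (interior_subset hv).1)) this
  · right
    intro s hs t ht hst
    have hderiv : ∀ v ∈ interior (Icc s t), HasDerivWithinAt f (h v * Real.sin (ψ v))
        (interior (Icc s t)) v := fun v hv =>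
      (hf v ((hA s hs).1.trans_le (interior_subset hv).1)).hasDerivWithinAt
    refine antitoneOn_of_hasDerivWithinAt_nonpos (convex_Icc s t) (hcont s hs t) hderiv
      (fun v hv => ?_) (left_mem_Icc.2 hst) (right_mem_Icc.2 hst) hst
    have := hsin s hs t ht v (interior_subset hv)
    rw [hi.neg_one_zpow] at this
    exact mul_nonpos_of_nonneg_of_nonpos (hh v ((hA s hs).1.trans_le (interior_subset hv).1))
      (by linarith)

/-- The phase governing the signs of the derivatives of `t ^ (-p) * cos t`, `t ^ (-p) * sin t`. -/
noncomputable def spiralPhase (p t : ℝ) : ℝ := t + Real.arctan (p / t)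

lemma spiralPhase_monotoneOn {p : ℝ} (hp : 1 ≤ p) : MonotoneOn (spiralPhase p) (Ioi 0) := by
  have hd : ∀ t ∈ Ioi (0 : ℝ), HasDerivAt (spiralPhase p)
      (1 + 1 / (1 + (p / t) ^ 2) * ((0 * t - p * 1) / t ^ 2)) t := fun t ht =>
    (hasDerivAt_id t).add (((hasDerivAt_const t p).div (hasDerivAt_id t) (ne_of_gt ht)).arctan)
  refine monotoneOn_of_hasDerivWithinAt_nonneg (convex_Ioi 0)
    (fun t ht => (hd t ht).continuousAt.continuousWithinAt)
    (fun t ht => (hd t (interior_subset ht)).hasDerivWithinAt) fun t ht => ?_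
  have ht : 0 < t := interior_subset ht
  have : 1 + 1 / (1 + (p / t) ^ 2) * ((0 * t - p * 1) / t ^ 2)
      = (t ^ 2 + p * (p - 1)) / (t ^ 2 + p ^ 2) := by
    field_simp
    ring
  rw [this]
  have : 0 ≤ p * (p - 1) := mul_nonneg (by linarith) (by linarith)
  positivity

lemma spiralPhase_le_add {p s t : ℝ} (hp : 0 ≤ p) (hs : 0 < s) (hst : s ≤ t) :
    spiralPhase p t ≤ spiralPhase p s + (t - s) := by
  have : Real.arctan (p / t) ≤ Real.arctan (p / s) :=
    Real.arctan_strictMono.monotone (by gcongr)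
  unfold spiralPhase
  linarith

lemma hasDerivAt_neg_spiralPoint_re (p : ℝ) {t : ℝ} (ht : 0 < t) :
    HasDerivAt (fun t => -(t ^ (-p) * Real.cos t))
      (t ^ (-p) / Real.cos (Real.arctan (p / t)) * Real.sin (spiralPhase p t)) t := by
  have h := (((Real.hasDerivAt_rpow_const (p := -p) (Or.inl ht.ne')).mul
    (Real.hasDerivAt_cos t)).neg)
  refine h.congr_deriv ?_
  have hc := (Real.cos_arctan_pos (p / t)).ne'
  have hs : Real.sin (Real.arctan (p / t)) = p / t * Real.cos (Real.arctan (p / t)) := by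
    rw [← Real.tan_mul_cos hc, Real.tan_arctan]
  rw [spiralPhase, Real.sin_add, hs, Real.rpow_sub_one ht.ne']
  field_simp
  ring

lemma hasDerivAt_spiralPoint_im (q : ℝ) {t : ℝ} (ht : 0 < t) :
    HasDerivAt (fun t => t ^ (-q) * Real.sin t)
      (t ^ (-q) / Real.cos (Real.arctan (q / t)) * Real.sin (spiralPhase q t + Real.pi / 2)) t := by
  have h := ((Real.hasDerivAt_rpow_const (p := -q) (Or.inl ht.ne')).mul
    (Real.hasDerivAt_sin t))
  refine h.congr_deriv ?_
  have hc := (Real.cos_arctan_pos (q / t)).ne'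
  have hs : Real.sin (Real.arctan (q / t)) = q / t * Real.cos (Real.arctan (q / t)) := by
    rw [← Real.tan_mul_cos hc, Real.tan_arctan]
  rw [Real.sin_add_pi_div_two, spiralPhase, Real.cos_add, hs, Real.rpow_sub_one ht.ne']
  field_simp
  ring

lemma floor_div_pi_eq_or {u v : ℝ} (h1 : u ≤ v) (h2 : v ≤ u + 1) :
    ⌊v / Real.pi⌋ = ⌊u / Real.pi⌋ ∨ ⌊v / Real.pi⌋ = ⌊u / Real.pi⌋ + 1 := by
  have h3 : ⌊u / Real.pi⌋ ≤ ⌊v / Real.pi⌋ := Int.floor_le_floor (by gcongr)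
  have h4 : ⌊v / Real.pi⌋ ≤ ⌊u / Real.pi⌋ + 1 := by
    rw [← Int.floor_add_one]
    refine Int.floor_le_floor ?_
    rw [div_add_one Real.pi_ne_zero]
    gcongr
    linarith [Real.pi_gt_three]
  omega

/-- A unit parameter interval of the spiral, restricted to a box, is essentially
one-dimensional. -/
lemma isCoverableBy_spiral_arc {p q k r a b ρ : ℝ} (hp : 1 ≤ p) (hq : 1 ≤ q) (hk : 0 < k)
    (hr : 0 < r) (hρ : 0 ≤ ρ) {A : Set ℝ} (hA : A ⊆ Icc k (k + 1))
    (hre : ∀ t ∈ A, |(spiralPoint p q t).re - a| ≤ ρ)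
    (him : ∀ t ∈ A, |(spiralPoint p q t).im - b| ≤ ρ) :
    IsCoverableBy (spiralPoint p q '' A) r (4 * (4 * ρ / r + 1)) := by
  classical
  have hpos : ∀ t ∈ A, 0 < t := fun t ht => hk.trans_le (hA ht).1
  set i₀ := ⌊spiralPhase p k / Real.pi⌋ with hi₀
  set j₀ := ⌊(spiralPhase q k + Real.pi / 2) / Real.pi⌋ with hj₀
  set T : Finset (ℤ × ℤ) := {i₀, i₀ + 1} ×ˢ {j₀, j₀ + 1} with hT
  let P : ℤ × ℤ → Set ℝ := fun m =>
    {t ∈ A | ⌊spiralPhase p t / Real.pi⌋ = m.1 ∧ ⌊(spiralPhase q t + Real.pi / 2) / Real.pi⌋ = m.2}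
  have hmono : ∀ m ∈ T, IsCoverableBy (spiralPoint p q '' P m) r (4 * ρ / r + 1) := by
    intro m _
    refine IsCoverableBy.of_monotone_coordinates _ _ hr hρ (fun t ht => hre t ht.1)
      (fun t ht => him t ht.1) ?_ ?_
    · have := monotoneOn_or_antitoneOn_of_deriv_eq_mul_sin
        (fun t ht => hasDerivAt_neg_spiralPoint_re p ht)
        (fun t ht => div_nonneg (Real.rpow_nonneg ht.le _) (Real.cos_arctan_pos _).le)
        (spiralPhase_monotoneOn hp) m.1 (A := P m) fun t ht => ⟨hpos t ht.1, ht.2.1⟩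
      rcases this with h | h
      · exact Or.inr fun s hs t ht hst => by simpa [spiralPoint] using h hs ht hst
      · exact Or.inl fun s hs t ht hst => by simpa [spiralPoint] using h hs ht hst
    · exact monotoneOn_or_antitoneOn_of_deriv_eq_mul_sin
        (fun t ht => hasDerivAt_spiralPoint_im q ht)
        (fun t ht => div_nonneg (Real.rpow_nonneg ht.le _) (Real.cos_arctan_pos _).le)
        ((spiralPhase_monotoneOn hq).add_const _) m.2 (A := P m)
        fun t ht => ⟨hpos t ht.1, ht.2.2⟩
  refine (IsCoverableBy.biUnion T hmono).mono ?_ ?_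
  · rintro _ ⟨t, ht, rfl⟩
    have hkt := hA ht
    have h1 := floor_div_pi_eq_or (spiralPhase_monotoneOn hp hk (hpos t ht) hkt.1)
      ((spiralPhase_le_add (by linarith) hk hkt.1).trans (by linarith [hkt.2]))
    have h2 := floor_div_pi_eq_or (u := spiralPhase q k + Real.pi / 2) (v := spiralPhase q t + Real.pi / 2)
      (by linarith [spiralPhase_monotoneOn hq hk (hpos t ht) hkt.1])
      (by linarith [spiralPhase_le_add (p := q) (by linarith) hk hkt.1, hkt.2])
    refine mem_iUnion₂.2 ⟨(⌊spiralPhase p t / Real.pi⌋, ⌊(spiralPhase q t + Real.pi / 2) / Real.pi⌋), ?_,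
      ⟨t, ⟨ht, rfl, rfl⟩, rfl⟩⟩
    simpa [hT] using ⟨h1, h2⟩
  · rw [Finset.sum_const, nsmul_eq_mul]
    have h4 : T.card ≤ 2 * 2 := by
      rw [hT, Finset.card_product]
      exact Nat.mul_le_mul Finset.card_le_two Finset.card_le_two
    gcongr
    exact_mod_cast h4

lemma abs_spiralPoint_re_le {p q k t : ℝ} (hp : 0 ≤ p) (hk : 0 < k) (hkt : k ≤ t) :
    |(spiralPoint p q t).re| ≤ k ^ (-p) := by
  have h1 : t ^ (-p) ≤ k ^ (-p) := Real.rpow_le_rpow_of_nonpos hk hkt (by linarith)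
  have h0 : 0 ≤ t ^ (-p) := Real.rpow_nonneg (hk.le.trans hkt) _
  calc |t ^ (-p) * Real.cos t| = t ^ (-p) * |Real.cos t| := by rw [abs_mul, abs_of_nonneg h0]
    _ ≤ t ^ (-p) * 1 := by gcongr; exact Real.abs_cos_le_one t
    _ ≤ k ^ (-p) := by linarith

lemma abs_spiralPoint_im_le {p q k t : ℝ} (hq : 0 ≤ q) (hk : 0 < k) (hkt : k ≤ t) :
    |(spiralPoint p q t).im| ≤ k ^ (-q) := by
  have h1 : t ^ (-q) ≤ k ^ (-q) := Real.rpow_le_rpow_of_nonpos hk hkt (by linarith)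
  have h0 : 0 ≤ t ^ (-q) := Real.rpow_nonneg (hk.le.trans hkt) _
  calc |t ^ (-q) * Real.sin t| = t ^ (-q) * |Real.sin t| := by rw [abs_mul, abs_of_nonneg h0]
    _ ≤ t ^ (-q) * 1 := by gcongr; exact Real.abs_sin_le_one t
    _ ≤ k ^ (-q) := by linarith

lemma exists_abs_spiralPoint_sub_le_min {p q k R : ℝ} (hp : 0 ≤ p) (hpq : p ≤ q) (hk : 1 ≤ k)
    (x : ℂ) : ∃ a b : ℝ, ∀ t, k ≤ t → spiralPoint p q t ∈ ball x R →
      |(spiralPoint p q t).re - a| ≤ min R (k ^ (-p)) ∧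
      |(spiralPoint p q t).im - b| ≤ min R (k ^ (-p)) := by
  rcases min_choice R (k ^ (-p)) with h | h <;> rw [h]
  · refine ⟨x.re, x.im, fun t _ hz => ?_⟩
    rw [mem_ball, Complex.dist_eq] at hz
    rw [← Complex.sub_re, ← Complex.sub_im]
    exact ⟨(Complex.abs_re_le_norm _).trans hz.le, (Complex.abs_im_le_norm _).trans hz.le⟩
  · refine ⟨0, 0, fun t hkt _ => ?_⟩
    rw [sub_zero, sub_zero]
    refine ⟨abs_spiralPoint_re_le hp (by linarith) hkt,
      (abs_spiralPoint_im_le (hp.trans hpq) (by linarith) hkt).trans ?_⟩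
    exact Real.rpow_le_rpow_of_exponent_le hk (by linarith)

lemma isCoverableBy_ball_inter_spiral {p q R r : ℝ} (hp : 1 ≤ p) (hpq : p ≤ q) (hr : 0 < r)
    (hR : 0 < R) (x : ℂ) {N : ℕ} (hN : 1 ≤ N) :
    IsCoverableBy (ball x R ∩ spiral p q) r
      (∑ k ∈ Finset.Icc 1 N, 4 * (4 * min R ((k : ℝ) ^ (-p)) / r + 1) +
        (2 * min R ((N : ℝ) ^ (-p)) / r + 1) * (2 * (N : ℝ) ^ (-q) / r + 1)) := by
  have hmin : ∀ k : ℕ, 0 ≤ min R ((k : ℝ) ^ (-p)) := fun k => le_min hR.le (by positivity)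
  let A : ℕ → Set ℝ := fun k => {t ∈ Icc (k : ℝ) (k + 1) | spiralPoint p q t ∈ ball x R}
  have harc : ∀ k ∈ Finset.Icc 1 N, IsCoverableBy (spiralPoint p q '' A k) r
      (4 * (4 * min R ((k : ℝ) ^ (-p)) / r + 1)) := by
    intro k hk
    have hk1 : (1 : ℝ) ≤ k := by exact_mod_cast (Finset.mem_Icc.1 hk).1
    obtain ⟨a, b, hab⟩ := exists_abs_spiralPoint_sub_le_min (q := q) (R := R)
      (by linarith) hpq hk1 x
    exact isCoverableBy_spiral_arc hp (hp.trans hpq) (by linarith) hr (hmin k)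
      (fun t ht => ht.1) (fun t ht => (hab t ht.1.1 ht.2).1) fun t ht => (hab t ht.1.1 ht.2).2
  have hN1 : (1 : ℝ) ≤ N := by exact_mod_cast hN
  have hrest : IsCoverableBy (spiralPoint p q '' {t | (N : ℝ) ≤ t ∧ spiralPoint p q t ∈ ball x R})
      r ((2 * min R ((N : ℝ) ^ (-p)) / r + 1) * (2 * (N : ℝ) ^ (-q) / r + 1)) := by
    obtain ⟨a, b, hab⟩ := exists_abs_spiralPoint_sub_le_min (q := q) (R := R)
      (by linarith) hpq hN1 x
    refine IsCoverableBy.of_box (a := a) (b := 0) hr (hmin N) (by positivity) ?_ ?_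
    · rintro _ ⟨t, ht, rfl⟩
      exact (hab t ht.1 ht.2).1
    · rintro _ ⟨t, ht, rfl⟩
      rw [sub_zero]
      exact abs_spiralPoint_im_le (by linarith) (by linarith) ht.1
  refine ((IsCoverableBy.biUnion _ harc).union hrest).mono ?_ le_rfl
  rintro z ⟨hzx, hz⟩
  obtain ⟨t, ht, rfl⟩ := mem_spiral_iff.1 hz
  rcases le_or_gt (N : ℝ) t with htN | htN
  · exact Or.inr ⟨t, ⟨htN, hzx⟩, rfl⟩
  · have h1 : 1 ≤ ⌊t⌋₊ := Nat.le_floor (by exact_mod_cast ht.le)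
    have h2 : ⌊t⌋₊ ≤ N := Nat.floor_le_of_le htN.le
    exact Or.inl (mem_iUnion₂.2 ⟨⌊t⌋₊, Finset.mem_Icc.2 ⟨h1, h2⟩, t,
      ⟨⟨Nat.floor_le (by linarith), (Nat.lt_floor_add_one t).le⟩, hzx⟩, rfl⟩)

lemma sqCoverNum_ball_inter_spiral_le {p q R r : ℝ} (hp : 1 ≤ p) (hpq : p ≤ q) (hr : 0 < r)
    (hr1 : r < 1) (hR : 0 < R) (x : ℂ) :
    ∃ N : ℕ, 1 ≤ N ∧ (N : ℝ) ≤ 2 * r ^ (-(1 / (1 + q))) ∧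
      (sqCoverNum (ball x R ∩ spiral p q) r : ℝ) ≤
        ∑ k ∈ Finset.Icc 1 N, 4 * (4 * min R ((k : ℝ) ^ (-p)) / r + 1) +
          (2 * min R ((N : ℝ) ^ (-p)) / r + 1) * (3 * N) := by
  have hq : 0 < 1 + q := by linarith
  set y := r ^ (-(1 / (1 + q))) with hy
  have hy1 : 1 ≤ y := Real.one_le_rpow_of_pos_of_le_one_of_nonpos hr hr1.le
    (by rw [neg_nonpos]; positivity)
  have hN : 1 ≤ ⌈y⌉₊ := Nat.one_le_ceil_iff.2 (by linarith)
  have hyN : y ≤ ⌈y⌉₊ := Nat.le_ceil y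
  refine ⟨⌈y⌉₊, hN, by linarith [Nat.ceil_lt_add_one (a := y) (by linarith)],
    (isCoverableBy_ball_inter_spiral hp hpq hr hR x hN).sqCoverNum_le.trans ?_⟩
  set N := ⌈y⌉₊
  have hN1 : (1 : ℝ) ≤ N := by exact_mod_cast hN
  have hNr : (N : ℝ) ^ (-q) ≤ N * r := by
    have h1 : (N : ℝ) ^ (-(1 + q)) ≤ y ^ (-(1 + q)) :=
      Real.rpow_le_rpow_of_nonpos (by linarith) hyN (by linarith)
    have h2 : y ^ (-(1 + q)) = r := by
      rw [hy, ← Real.rpow_mul hr.le]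
      rw [show -(1 / (1 + q)) * -(1 + q) = 1 by field_simp, Real.rpow_one]
    calc (N : ℝ) ^ (-q) = N ^ (1 + -(1 + q)) := by ring_nf
      _ = N * N ^ (-(1 + q)) := by rw [Real.rpow_add (by linarith), Real.rpow_one]
      _ ≤ N * r := by gcongr; linarith
  have hmin : 0 ≤ min R ((N : ℝ) ^ (-p)) := le_min hR.le (by positivity)
  gcongr
  have : 2 * (N : ℝ) ^ (-q) / r ≤ 2 * N := by
    rw [div_le_iff₀ hr]; linarith
  linarith

lemma rpow_div_self_rpow {r θ α : ℝ} (hr : 0 < r) :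
    (r ^ θ / r) ^ α = r ^ (-((1 - θ) * α)) := by
  rw [← Real.rpow_sub_one hr.ne', ← Real.rpow_mul hr.le]
  ring_nf

lemma sqCoverNum_ball_inter_le_sq {F : Set ℂ} {R r : ℝ} (hr : 0 < r) (hrR : r ≤ R) (x : ℂ) :
    IsCoverableBy (ball x R ∩ F) r (9 * (R / r) ^ (2 : ℝ)) := by
  have hz : ∀ z ∈ ball x R ∩ F, ‖z - x‖ ≤ R := fun z hz => by
    have := hz.1
    rw [mem_ball, Complex.dist_eq] at this
    exact this.le
  refine (IsCoverableBy.of_box (a := x.re) (b := x.im) hr (hr.le.trans hrR) (hr.le.trans hrR)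
    (fun z h => ?_) fun z h => ?_).mono Subset.rfl ?_
  · exact (Complex.abs_re_le_norm (z - x)).trans (hz z h)
  · exact (Complex.abs_im_le_norm (z - x)).trans (hz z h)
  · have : 1 ≤ R / r := (one_le_div hr).2 hrR
    rw [Real.rpow_two, mul_div_assoc]
    nlinarith

lemma sqCoverNum_spiral_le_of_thick {p q θ r : ℝ} (hp : 1 ≤ p) (hpq : p ≤ q) (hθ1 : θ < 1)
    (hr : 0 < r) (hr1 : r < 1) (x : ℂ) :
    (sqCoverNum (ball x (r ^ θ) ∩ spiral p q) r : ℝ) ≤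
      58 * (r ^ θ / r) ^ ((2 + q - θ * (1 + q)) / ((1 + q) * (1 - θ))) := by
  have hR : 0 < r ^ θ := Real.rpow_pos_of_pos hr θ
  obtain ⟨N, hN, hNr, hcov⟩ := sqCoverNum_ball_inter_spiral_le hp hpq hr hr1 hR x
  refine hcov.trans ?_
  have hD : 1 ≤ r ^ θ / r := by
    rw [one_le_div hr]
    calc r = r ^ (1 : ℝ) := (Real.rpow_one r).symm
      _ ≤ r ^ θ := Real.rpow_le_rpow_of_exponent_ge hr hr1.le hθ1.le
  have hsum : ∑ k ∈ Finset.Icc 1 N, 4 * (4 * min (r ^ θ) ((k : ℝ) ^ (-p)) / r + 1) ≤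
      N * (20 * (r ^ θ / r)) := by
    have : ∀ k ∈ Finset.Icc 1 N, 4 * (4 * min (r ^ θ) ((k : ℝ) ^ (-p)) / r + 1) ≤
        20 * (r ^ θ / r) := by
      intro k _
      have : 4 * min (r ^ θ) ((k : ℝ) ^ (-p)) / r ≤ 4 * (r ^ θ / r) := by
        rw [mul_div_assoc]; gcongr; exact min_le_left _ _
      linarith
    simpa using Finset.sum_le_card_nsmul _ _ _ this
  have hlast : (2 * min (r ^ θ) ((N : ℝ) ^ (-p)) / r + 1) * (3 * N) ≤
      3 * (r ^ θ / r) * (3 * N) := by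
    gcongr
    have : 2 * min (r ^ θ) ((N : ℝ) ^ (-p)) / r ≤ 2 * (r ^ θ / r) := by
      rw [mul_div_assoc]; gcongr; exact min_le_left _ _
    linarith
  have hexp : (r ^ θ / r) ^ ((2 + q - θ * (1 + q)) / ((1 + q) * (1 - θ))) =
      r ^ (-(1 / (1 + q))) * (r ^ θ / r) := by
    have h1 : 1 - θ ≠ 0 := by linarith
    have h2 : 1 + q ≠ 0 := by linarith
    rw [rpow_div_self_rpow hr, ← Real.rpow_sub_one hr.ne', ← Real.rpow_add hr]
    congr 1
    field_simp
    ring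
  rw [hexp]
  calc _ ≤ 29 * N * (r ^ θ / r) := by linarith
    _ ≤ 29 * (2 * r ^ (-(1 / (1 + q)))) * (r ^ θ / r) := by gcongr
    _ = _ := by ring

lemma min_rpow_neg_le {p R k : ℝ} (hp : 1 ≤ p) (hR : 0 < R) (hk : 0 < k) :
    min R (k ^ (-p)) ≤ R ^ (1 - 1 / p) * k⁻¹ := by
  have hp0 : 0 < p := by linarith
  have h1 : 0 ≤ 1 - 1 / p := by
    rw [sub_nonneg, div_le_one hp0]; exact hp
  have hm : 0 < min R (k ^ (-p)) := lt_min hR (Real.rpow_pos_of_pos hk _)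
  calc min R (k ^ (-p)) = min R (k ^ (-p)) ^ (1 - 1 / p) * min R (k ^ (-p)) ^ (1 / p) := by
        rw [← Real.rpow_add hm, sub_add_cancel, Real.rpow_one]
    _ ≤ R ^ (1 - 1 / p) * (k ^ (-p)) ^ (1 / p) := by
        gcongr
        · exact min_le_left _ _
        · exact min_le_right _ _
    _ = R ^ (1 - 1 / p) * k⁻¹ := by
        rw [← Real.rpow_mul hk.le, show -p * (1 / p) = -1 by field_simp, Real.rpow_neg_one]

lemma exists_sqCoverNum_spiral_le_of_thin {p q θ α : ℝ} (hp : 1 ≤ p) (hpq : p ≤ q)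
    (hθ : θ < p / (1 + q)) (hα : 1 - θ * (1 - 1 / p) < (1 - θ) * α) :
    ∃ C : ℝ, 0 < C ∧ ∀ r : ℝ, 0 < r → r < 1 → ∀ x : ℂ,
      (sqCoverNum (ball x (r ^ θ) ∩ spiral p q) r : ℝ) ≤ C * (r ^ θ / r) ^ α := by
  have hp0 : 0 < p := by linarith
  have hq0 : 0 < 1 + q := by linarith
  set β := 1 - θ * (1 - 1 / p) with hβ
  set ε := (1 - θ) * α - β with hε
  have hε0 : 0 < ε := sub_pos.2 hα
  have hβq : 1 / (1 + q) ≤ β := by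
    have h1 : 0 ≤ 1 - 1 / p := by rw [sub_nonneg, div_le_one hp0]; exact hp
    have h2 : θ * (1 - 1 / p) ≤ p / (1 + q) * (1 - 1 / p) := by gcongr
    have h3 : p / (1 + q) * (1 - 1 / p) = (p - 1) / (1 + q) := by field_simp
    have h4 : 1 / (1 + q) + (p - 1) / (1 + q) ≤ 1 := by
      rw [← add_div, div_le_one hq0]; linarith
    linarith
  refine ⟨36 + 16 * (2 ^ ε / ε), by positivity, fun r hr hr1 x => ?_⟩
  have hR : 0 < r ^ θ := Real.rpow_pos_of_pos hr θ
  obtain ⟨N, hN, hNr, hcov⟩ := sqCoverNum_ball_inter_spiral_le hp hpq hr hr1 hR x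
  refine hcov.trans ?_
  have hN1 : (1 : ℝ) ≤ N := by exact_mod_cast hN
  set D := r ^ (-β) with hD
  have hD0 : 0 < D := Real.rpow_pos_of_pos hr _
  have hRD : (r ^ θ) ^ (1 - 1 / p) / r = D := by
    rw [← Real.rpow_mul hr.le, ← Real.rpow_sub_one hr.ne', hD, hβ]
    ring_nf
  have hmin : ∀ k : ℝ, 1 ≤ k → min (r ^ θ) (k ^ (-p)) / r ≤ D * k⁻¹ := by
    intro k hk
    rw [← hRD, div_mul_eq_mul_div]
    gcongr
    exact min_rpow_neg_le hp hR (by linarith)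
  have hND : (N : ℝ) ≤ 2 * D := by
    refine hNr.trans ?_
    gcongr
    exact Real.rpow_le_rpow_of_exponent_ge hr hr1.le (by linarith)
  have hsum : ∑ k ∈ Finset.Icc 1 N, 4 * (4 * min (r ^ θ) ((k : ℝ) ^ (-p)) / r + 1) ≤
      16 * D * (1 + Real.log N) + 4 * N := by
    calc _ ≤ ∑ k ∈ Finset.Icc 1 N, (16 * D * (k : ℝ)⁻¹ + 4) := by
          refine Finset.sum_le_sum fun k hk => ?_
          have := hmin k (by exact_mod_cast (Finset.mem_Icc.1 hk).1)
          rw [mul_div_assoc]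
          linarith
      _ = 16 * D * (harmonic N : ℝ) + 4 * N := by
          rw [Finset.sum_add_distrib, ← Finset.mul_sum, harmonic_eq_sum_Icc]
          push_cast
          simp [mul_comm]
      _ ≤ _ := by
          gcongr
          exact harmonic_le_one_add_log N
  have hlast : (2 * min (r ^ θ) ((N : ℝ) ^ (-p)) / r + 1) * (3 * N) ≤ 6 * D + 3 * N := by
    have := hmin N hN1
    calc _ ≤ (2 * (D * (N : ℝ)⁻¹) + 1) * (3 * N) := by
          rw [mul_div_assoc]; gcongr
      _ = _ := by field_simp; ring
  have hlog : Real.log N ≤ 2 ^ ε / ε * r ^ (-ε) := by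
    have hN2 : (N : ℝ) ≤ 2 * r⁻¹ := by
      refine hNr.trans ?_
      rw [← Real.rpow_neg_one]
      gcongr 2 * ?_
      refine Real.rpow_le_rpow_of_exponent_ge hr hr1.le ?_
      rw [neg_le_neg_iff, div_le_one hq0]
      linarith
    calc Real.log N ≤ (N : ℝ) ^ ε / ε := Real.log_le_rpow_div (by linarith) hε0
      _ ≤ (2 * r⁻¹) ^ ε / ε := by gcongr
      _ = 2 ^ ε / ε * r ^ (-ε) := by
          rw [Real.mul_rpow (by norm_num) (by positivity), Real.inv_rpow hr.le,
            Real.rpow_neg hr.le]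
          ring
  have hrε : 1 ≤ r ^ (-ε) :=
    Real.one_le_rpow_of_pos_of_le_one_of_nonpos hr hr1.le (by linarith)
  have hexp : (r ^ θ / r) ^ α = D * r ^ (-ε) := by
    rw [rpow_div_self_rpow hr, hD, ← Real.rpow_add hr, hε]
    ring_nf
  rw [hexp]
  calc _ ≤ D * (36 + 16 * Real.log N) := by linarith
    _ ≤ D * (36 * r ^ (-ε) + 16 * (2 ^ ε / ε * r ^ (-ε))) := by gcongr; linarith
    _ = _ := by ring

lemma exists_rpow_neg_sub_eq {q u v : ℝ} (hu : 0 < u) (huv : u ≤ v) :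
    ∃ c ∈ Icc u v, u ^ (-q) - v ^ (-q) = q * c ^ (-q - 1) * (v - u) := by
  rcases huv.eq_or_lt with rfl | h
  · exact ⟨u, left_mem_Icc.2 le_rfl, by simp⟩
  have hd : ∀ t, u ≤ t → HasDerivAt (fun t : ℝ => t ^ (-q)) (-q * t ^ (-q - 1)) t := fun t ht =>
    Real.hasDerivAt_rpow_const (Or.inl (hu.trans_le ht).ne')
  obtain ⟨c, hc, hce⟩ := exists_hasDerivAt_eq_slope _ _ h
    (fun t ht => (hd t ht.1).continuousAt.continuousWithinAt) fun t ht => hd t ht.1.le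
  refine ⟨c, Ioo_subset_Icc_self hc, ?_⟩
  rw [eq_div_iff (sub_pos.2 h).ne'] at hce
  linarith

lemma rpow_neg_sub_le {q a u v : ℝ} (hq : 0 ≤ q) (ha : 0 < a) (hau : a ≤ u) (huv : u ≤ v) :
    u ^ (-q) - v ^ (-q) ≤ q * a ^ (-q - 1) * (v - u) := by
  obtain ⟨c, hc, h⟩ := exists_rpow_neg_sub_eq (q := q) (ha.trans_le hau) huv
  have := Real.rpow_le_rpow_of_nonpos ha (hau.trans hc.1) (show -q - 1 ≤ 0 by linarith)
  rw [h]
  have := sub_nonneg.2 huv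
  gcongr

lemma le_rpow_neg_sub {q u v T : ℝ} (hq : 0 ≤ q) (hu : 0 < u) (huv : u ≤ v) (hvT : v ≤ T) :
    q * T ^ (-q - 1) * (v - u) ≤ u ^ (-q) - v ^ (-q) := by
  obtain ⟨c, hc, h⟩ := exists_rpow_neg_sub_eq (q := q) hu huv
  have := Real.rpow_le_rpow_of_nonpos (hu.trans_le hc.1) (hc.2.trans hvT)
    (show -q - 1 ≤ 0 by linarith)
  rw [h]
  have := sub_nonneg.2 huv
  gcongr

lemma half_le_sin {s : ℝ} (hs : s ∈ Icc (Real.pi / 6) (Real.pi / 2)) : 1 / 2 ≤ Real.sin s := by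
  rw [← Real.sin_pi_div_six]
  exact Real.sin_le_sin_of_le_of_le_pi_div_two (by linarith [Real.pi_pos]) hs.2 hs.1

/-- Points on different turns of the spiral with equal real parts are vertically separated. -/
lemma lt_spiral_im_sub {p q s s' t t' T : ℝ} (hp : 0 ≤ p) (hq : 1 ≤ q)
    (hs : s ∈ Icc (Real.pi / 6) (Real.pi / 2)) (hs' : s' ∈ Icc (Real.pi / 6) (Real.pi / 2)) (ht : 0 < t)
    (htt : t + 1 ≤ t') (htT : t' ≤ T) (hX : t ^ (-p) * Real.cos s = t' ^ (-p) * Real.cos s') :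
    T ^ (-q - 1) / 2 ≤ t ^ (-q) * Real.sin s - t' ^ (-q) * Real.sin s' := by
  have hpi := Real.pi_pos
  have ht' : 0 < t' := by linarith
  have hcos : Real.cos s ≤ Real.cos s' := by
    refine le_of_mul_le_mul_left ?_ (Real.rpow_pos_of_pos ht' (-p))
    rw [← hX]
    have := Real.rpow_le_rpow_of_nonpos ht (show t ≤ t' by linarith) (neg_nonpos.2 hp)
    have := Real.cos_nonneg_of_neg_pi_div_two_le_of_le (show -(Real.pi / 2) ≤ s by linarith [hs.1]) hs.2
    gcongr
  have hss : s' ≤ s := by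
    by_contra! h
    have := Real.cos_lt_cos_of_nonneg_of_le_pi_div_two (by linarith [hs.1]) hs'.2 h
    linarith
  have hsin : Real.sin s' ≤ Real.sin s :=
    Real.sin_le_sin_of_le_of_le_pi_div_two (by linarith [hs'.1]) hs.2 hss
  have hgap := le_rpow_neg_sub (q := q) (by linarith) ht (show t ≤ t' by linarith) htT
  have hT0 : 0 < T ^ (-q - 1) := Real.rpow_pos_of_pos (by linarith) _
  have hT : T ^ (-q - 1) ≤ t ^ (-q) - t' ^ (-q) := by
    refine le_trans ?_ hgap
    have : 1 ≤ q * (t' - t) := by nlinarith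
    nlinarith
  have hs2 := half_le_sin hs
  have h0 : 0 < t' ^ (-q) := Real.rpow_pos_of_pos ht' _
  nlinarith [mul_le_mul_of_nonneg_left hsin h0.le, mul_le_mul_of_nonneg_left hs2 hT0.le,
    mul_le_mul_of_nonneg_right hT (by linarith : 0 ≤ Real.sin s)]

lemma exists_spiral_re_eq {p X T : ℝ} (hp : 0 ≤ p) {k : ℕ} (hX : 0 ≤ X)
    (hT : Real.pi / 6 + k * (2 * Real.pi) ≤ T) (hXT : X ≤ T ^ (-p) / 2) :
    ∃ s ∈ Icc (Real.pi / 6) (Real.pi / 2), (s + k * (2 * Real.pi)) ^ (-p) * Real.cos s = X := by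
  have hpi := Real.pi_pos
  have hpos : ∀ s ∈ Icc (Real.pi / 6) (Real.pi / 2), 0 < s + k * (2 * Real.pi) := fun s hs => by
    have := hs.1
    have : (0 : ℝ) ≤ k * (2 * Real.pi) := by positivity
    linarith
  have hcont : ContinuousOn (fun s => (s + k * (2 * Real.pi)) ^ (-p) * Real.cos s)
      (Icc (Real.pi / 6) (Real.pi / 2)) := by
    refine ContinuousOn.mul (ContinuousOn.rpow_const (by fun_prop) fun s hs => ?_) (by fun_prop)
    exact Or.inl (hpos s hs).ne'
  have h6 : Real.pi / 6 ∈ Icc (Real.pi / 6) (Real.pi / 2) := ⟨le_rfl, by linarith⟩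
  refine intermediate_value_Icc' (by linarith) hcont ⟨by simpa using hX, hXT.trans ?_⟩
  have h1 : T ^ (-p) ≤ (Real.pi / 6 + k * (2 * Real.pi)) ^ (-p) :=
    Real.rpow_le_rpow_of_nonpos (hpos _ h6) hT (by linarith)
  have h2 : 1 / 2 ≤ Real.cos (Real.pi / 6) := by
    rw [← Real.cos_pi_div_three]
    exact Real.cos_le_cos_of_nonneg_of_le_pi (by linarith) (by linarith) (by linarith)
  have h0 : 0 ≤ T ^ (-p) := Real.rpow_nonneg (by linarith [hpos _ h6]) _
  nlinarith

lemma le_sqCoverNum_ball_inter_spiral {p q r R : ℝ} (hp : 1 ≤ p) (hpq : p ≤ q) {K L M : ℕ}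
    (hK : 1 ≤ K) (hLK : L ≤ K) (hr : 0 < r) (hrR : r ≤ R)
    (hgap : r < (4 * Real.pi * K) ^ (-q - 1) / 2) (hwidth : 2 * r * M ≤ (4 * Real.pi * K) ^ (-p) / 2)
    (hwidthR : 2 * r * M ≤ R / 8) (hheight : q * (2 * Real.pi * L) * (2 * Real.pi * K) ^ (-q - 1) ≤ R / 4) :
    ∃ x ∈ spiral p q,
      (L : ℝ) * M ≤ sqCoverNum (ball x R ∩ spiral p q) r := by
  have hpi := Real.pi_gt_three
  have hK1 : (1 : ℝ) ≤ K := by exact_mod_cast hK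
  have hLK' : (L : ℝ) ≤ K := by exact_mod_cast hLK
  have hKpi : 2 * Real.pi ≤ K * (2 * Real.pi) := by nlinarith
  have hturn : ∀ i : Fin L, (((K + i : ℕ) : ℝ) * (2 * Real.pi)) + 2 * Real.pi ≤ 4 * Real.pi * K ∧
      (K : ℝ) * (2 * Real.pi) ≤ ((K + i : ℕ) : ℝ) * (2 * Real.pi) ∧
      ((K + i : ℕ) : ℝ) * (2 * Real.pi) + 2 * Real.pi ≤ K * (2 * Real.pi) + 2 * Real.pi * L := by
    intro i
    have h1 : ((i : ℕ) : ℝ) + 1 ≤ L := by exact_mod_cast i.2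
    have h2 : (0 : ℝ) ≤ ((i : ℕ) : ℝ) := Nat.cast_nonneg _
    push_cast
    refine ⟨?_, ?_, ?_⟩ <;> nlinarith
  have hex : ∀ (i : Fin L) (m : Fin M), ∃ s ∈ Icc (Real.pi / 6) (Real.pi / 2),
      (s + ((K + i : ℕ) : ℝ) * (2 * Real.pi)) ^ (-p) * Real.cos s = 2 * r * m := by
    intro i m
    refine exists_spiral_re_eq (T := 4 * Real.pi * K) (by linarith) (by positivity)
      (by linarith [(hturn i).1]) (le_trans ?_ hwidth)
    have : ((m : ℕ) : ℝ) ≤ M := by exact_mod_cast m.2.le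
    gcongr
  choose s hs hre using hex
  set t : Fin L → Fin M → ℝ := fun i m => s i m + ((K + i : ℕ) : ℝ) * (2 * Real.pi) with ht
  have hcos : ∀ i m, Real.cos (t i m) = Real.cos (s i m) := fun i m =>
    Real.cos_add_nat_mul_two_pi _ _
  have hsin : ∀ i m, Real.sin (t i m) = Real.sin (s i m) := fun i m =>
    Real.sin_add_nat_mul_two_pi _ _
  have htK : ∀ i m, K * (2 * Real.pi) ≤ t i m := fun i m => by
    have := (hs i m).1
    have := (hturn i).2.1
    simp only [ht]
    linarith
  set t₀ : ℝ := Real.pi / 2 + K * (2 * Real.pi) with ht₀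
  have hzre : ∀ i m, (spiralPoint p q (t i m)).re = 2 * r * m := fun i m => by
    rw [spiralPoint, hcos, ← hre i m]
  have hzim : ∀ i m, (spiralPoint p q (t i m)).im = t i m ^ (-q) * Real.sin (s i m) :=
    fun i m => by rw [spiralPoint, hsin]
  have hx : spiralPoint p q t₀ = ⟨0, t₀ ^ (-q)⟩ := by
    rw [spiralPoint, ht₀, Real.cos_add_nat_mul_two_pi, Real.sin_add_nat_mul_two_pi]
    simp
  have hball : ∀ i m, spiralPoint p q (t i m) ∈ ball (spiralPoint p q t₀) R := by
    intro i m
    have hm : 2 * r * (m : ℕ) ≤ R / 8 := by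
      refine le_trans ?_ hwidthR
      have : ((m : ℕ) : ℝ) ≤ M := by exact_mod_cast m.2.le
      gcongr
    have ht0 : 1 < t i m := by linarith [htK i m]
    have hvert : |t i m ^ (-q) - t₀ ^ (-q)| ≤ R / 4 := by
      have hdist : |t i m - t₀| ≤ 2 * Real.pi * L := by
        have h1 := hs i m
        have h2 := hturn i
        simp only [ht, ht₀]
        rw [abs_le]
        constructor <;> linarith [h1.1, h1.2]
      have hb : |t i m ^ (-q) - t₀ ^ (-q)| ≤ q * (K * (2 * Real.pi)) ^ (-q - 1) * |t i m - t₀| := by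
        rcases le_total (t i m) t₀ with h | h
        · rw [abs_of_nonneg (sub_nonneg.2 (Real.rpow_le_rpow_of_nonpos (by linarith) h
            (by linarith))), abs_of_nonpos (sub_nonpos.2 h), neg_sub]
          exact rpow_neg_sub_le (by linarith) (by linarith) (htK i m) h
        · rw [abs_of_nonpos (sub_nonpos.2 (Real.rpow_le_rpow_of_nonpos (by linarith) h
            (by linarith))), abs_of_nonneg (sub_nonneg.2 h), neg_sub]
          exact rpow_neg_sub_le (by linarith) (by linarith) (by linarith) h
      calc _ ≤ q * (K * (2 * Real.pi)) ^ (-q - 1) * (2 * Real.pi * L) := by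
            refine hb.trans ?_
            have : 0 ≤ q := by linarith
            gcongr
        _ = q * (2 * Real.pi * L) * (2 * Real.pi * K) ^ (-q - 1) := by ring_nf
        _ ≤ R / 4 := hheight
    have hsc : t i m ^ (-q) * (1 - Real.sin (s i m)) ≤ 2 * r * (m : ℕ) := by
      rw [← hre i m]
      have hc := Real.cos_nonneg_of_neg_pi_div_two_le_of_le
        (show -(Real.pi / 2) ≤ s i m by linarith [(hs i m).1]) (hs i m).2
      have h1 : 1 - Real.sin (s i m) ≤ Real.cos (s i m) := by
        nlinarith [Real.sin_sq_add_cos_sq (s i m), half_le_sin (hs i m),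
          Real.sin_le_one (s i m)]
      have h2 : t i m ^ (-q) ≤ t i m ^ (-p) :=
        Real.rpow_le_rpow_of_exponent_le ht0.le (by linarith)
      have h3 : 0 ≤ 1 - Real.sin (s i m) := by linarith [Real.sin_le_one (s i m)]
      exact mul_le_mul h2 h1 h3 (by positivity)
    have hsc0 : 0 ≤ t i m ^ (-q) * (1 - Real.sin (s i m)) :=
      mul_nonneg (by positivity) (by linarith [Real.sin_le_one (s i m)])
    rw [mem_ball, Complex.dist_eq]
    refine (Complex.norm_le_abs_re_add_abs_im _).trans_lt ?_
    rw [Complex.sub_re, Complex.sub_im, hzre, hzim, hx]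
    have h1 : |2 * r * (m : ℕ) - 0| ≤ R / 8 := by
      rw [sub_zero, abs_of_nonneg (by positivity)]; exact hm
    have h2 : |t i m ^ (-q) * Real.sin (s i m) - t₀ ^ (-q)| ≤ R / 4 + R / 8 := by
      have := abs_le.1 hvert
      rw [abs_le]
      constructor <;> linarith
    simp only
    linarith
  have hsep : ∀ i j m, i < j →
      r < (spiralPoint p q (t i m)).im - (spiralPoint p q (t j m)).im := by
    intro i j m hij
    rw [hzim, hzim]
    refine hgap.trans_le (lt_spiral_im_sub (p := p) (by linarith) (by linarith) (hs i m) (hs j m)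
      (by linarith [htK i m]) ?_ ?_ ?_)
    · have h1 : ((i : ℕ) : ℝ) + 1 ≤ ((j : ℕ) : ℝ) := by exact_mod_cast hij
      have := (hs i m).2
      have := (hs j m).1
      simp only [ht]
      push_cast
      nlinarith
    · have := (hs j m).2
      have := (hturn j).1
      simp only [ht]
      linarith
    · rw [hre, hre]
  refine ⟨spiralPoint p q t₀, mem_spiral_iff.2 ⟨t₀, by linarith, rfl⟩, ?_⟩
  have := le_sqCoverNum_of_separated (E := ball (spiralPoint p q t₀) R ∩ spiral p q) (r := r)
    ⟨_, sqCoverNum_ball_inter_le_sq hr hrR _⟩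
    (fun x : Fin L × Fin M => spiralPoint p q (t x.1 x.2))
    (fun x => ⟨hball x.1 x.2, mem_spiral_iff.2 ⟨_, by linarith [htK x.1 x.2], rfl⟩⟩) ?_
  · rw [Fintype.card_prod, Fintype.card_fin, Fintype.card_fin] at this
    exact_mod_cast this
  · rintro ⟨i, m⟩ ⟨j, m'⟩ hne
    rcases eq_or_ne m m' with rfl | hm
    · right
      have hij : i ≠ j := fun h => hne (by rw [h])
      rcases hij.lt_or_gt with h | h
      · exact (hsep i j m h).trans_le (le_abs_self _)
      · rw [abs_sub_comm]
        exact (hsep j i m h).trans_le (le_abs_self _)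
    · left
      simp only [hzre]
      have h1 : (1 : ℝ) ≤ |((m : ℕ) : ℝ) - ((m' : ℕ) : ℝ)| := by
        have : ((m : ℕ) : ℤ) - ((m' : ℕ) : ℤ) ≠ 0 := by
          have := Fin.val_ne_of_ne hm
          omega
        exact_mod_cast Int.one_le_abs this
      rw [← mul_sub, abs_mul, abs_of_pos (by positivity : 0 < 2 * r)]
      nlinarith

lemma half_le_floor {y : ℝ} (hy : 1 ≤ y) : y / 2 ≤ ⌊y⌋₊ := by
  have h1 : (1 : ℝ) ≤ ⌊y⌋₊ := by exact_mod_cast Nat.le_floor (by simpa using hy)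
  linarith [Nat.lt_floor_add_one y]

lemma eventually_le_mul_rpow_neg {c δ : ℝ} (C : ℝ) (hc : 0 < c) (hδ : 0 < δ) :
    ∀ᶠ r : ℝ in nhdsWithin 0 (Ioi 0), C < c * r ^ (-δ) :=
  ((tendsto_rpow_neg_nhdsGT_zero (neg_lt_zero.2 hδ)).const_mul_atTop hc).eventually_gt_atTop C

lemma eventually_mem_Ioo : ∀ᶠ r : ℝ in nhdsWithin 0 (Ioi 0), 0 < r ∧ r < 1 :=
  Ioo_mem_nhdsGT one_pos

lemma le_rpow_of_lt_one {r θ : ℝ} (hθ1 : θ < 1) (hr : 0 < r) (hr1 : r < 1) : r ≤ r ^ θ := by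
  simpa using Real.rpow_le_rpow_of_exponent_ge hr hr1.le hθ1.le

lemma two_mem_assouadSpectrum_exponents {θ : ℝ} (hθ1 : θ < 1) (F : Set ℂ) :
    (0 : ℝ) ≤ 2 ∧ ∃ C : ℝ, 0 < C ∧ ∀ r : ℝ, 0 < r → r < 1 → ∀ x ∈ F,
      (sqCoverNum (ball x (r ^ θ) ∩ F) r : ℝ) ≤ C * (r ^ θ / r) ^ (2 : ℝ) :=
  ⟨by norm_num, 9, by norm_num, fun _ hr hr1 x _ =>
    (sqCoverNum_ball_inter_le_sq hr (le_rpow_of_lt_one hθ1 hr hr1) x).sqCoverNum_le⟩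

lemma assouadSpectrum_le {θ α C : ℝ} {F : Set ℂ} (hα : 0 ≤ α) (hC : 0 < C)
    (h : ∀ r : ℝ, 0 < r → r < 1 → ∀ x ∈ F,
      (sqCoverNum (ball x (r ^ θ) ∩ F) r : ℝ) ≤ C * (r ^ θ / r) ^ α) :
    assouadSpectrum θ F ≤ α :=
  csInf_le ⟨0, fun _ h => h.1⟩ ⟨hα, C, hC, h⟩

lemma le_assouadSpectrum {θ β c : ℝ} {F : Set ℂ} (hθ1 : θ < 1) (hc : 0 < c)
    (h : ∀ᶠ r : ℝ in nhdsWithin 0 (Ioi 0),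
      ∃ x ∈ F, c * r ^ (-β) ≤ sqCoverNum (ball x (r ^ θ) ∩ F) r) :
    β / (1 - θ) ≤ assouadSpectrum θ F := by
  refine le_csInf ⟨2, two_mem_assouadSpectrum_exponents hθ1 F⟩ ?_
  rintro α ⟨-, C, hC, hcov⟩
  by_contra! hlt
  rw [lt_div_iff₀ (by linarith)] at hlt
  obtain ⟨r, ⟨x, hx, hle⟩, ⟨hr, hr1⟩, hbig⟩ := (h.and (eventually_mem_Ioo.and
    (eventually_le_mul_rpow_neg C hc (sub_pos.2 hlt)))).exists
  have h1 := hle.trans (hcov r hr hr1 x hx)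
  rw [rpow_div_self_rpow hr] at h1
  have h2 : r ^ (-β) = r ^ (-(β - α * (1 - θ))) * r ^ (-((1 - θ) * α)) := by
    rw [← Real.rpow_add hr]; ring_nf
  rw [h2, ← mul_assoc] at h1
  exact absurd (le_of_mul_le_mul_right h1 (Real.rpow_pos_of_pos hr _)) (not_le.2 hbig)

/-- The lower bound coming from turns of the spiral whose mutual distances are comparable to the
covering scale. -/
lemma le_assouadSpectrum_spiral_of_thick {p q θ γ : ℝ} (hp : 1 ≤ p) (hpq : p ≤ q) (hθ1 : θ < 1)
    (hθ : p / (1 + q) ≤ θ) (hγ : 0 < γ) (hγθ : γ ≤ 1 - θ) (hγq : γ ≤ 1 / (1 + q)) :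
    (γ + (1 - θ)) / (1 - θ) ≤ assouadSpectrum θ (spiral p q) := by
  have hpi := Real.pi_gt_three
  have hq1 : 1 ≤ q := hp.trans hpq
  have hq0 : 0 < 1 + q := by linarith
  set c₁ : ℝ := 1 / (16 * Real.pi) with hc₁
  set c₂ : ℝ := 1 / (8 * Real.pi * q * 16 ^ (q + 1)) with hc₂
  have hc₁0 : 0 < c₁ := by positivity
  have hc₂0 : 0 < c₂ := by positivity
  have hc₂₁ : c₂ ≤ c₁ / 2 := by
    have : (16 : ℝ) ≤ 16 ^ (q + 1) := by
      simpa using Real.rpow_le_rpow_of_exponent_le (x := 16) (by norm_num)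
        (show (1 : ℝ) ≤ q + 1 by linarith)
    rw [hc₁, hc₂, div_div]
    refine one_div_le_one_div_of_le (by positivity) ?_
    nlinarith [mul_le_mul hq1 this (by norm_num) (by linarith)]
  refine le_assouadSpectrum (c := c₂ / 2 * (1 / 16 / 2)) hθ1 (by positivity) ?_
  filter_upwards [eventually_mem_Ioo, eventually_le_mul_rpow_neg 1 hc₂0 hγ,
    eventually_le_mul_rpow_neg 1 (show (0 : ℝ) < 1 / 16 by norm_num) (sub_pos.2 hθ1)]
    with r ⟨hr, hr1⟩ hL hM
  set y : ℝ := r ^ (-(1 / (1 + q))) with hy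
  have hy0 : 0 < y := Real.rpow_pos_of_pos hr _
  have hγy : r ^ (-γ) ≤ y := Real.rpow_le_rpow_of_exponent_ge hr hr1.le (by linarith)
  have hRr : r ^ (-(1 - θ)) = r ^ θ / r := by
    rw [← Real.rpow_sub_one hr.ne']; ring_nf
  have hγR : r ^ (-γ) ≤ r ^ θ / r := by
    rw [← hRr]
    exact Real.rpow_le_rpow_of_exponent_ge hr hr1.le (by linarith)
  have hK1 : 1 ≤ c₁ * y := by nlinarith
  have hKle : (⌊c₁ * y⌋₊ : ℝ) ≤ c₁ * y := Nat.floor_le (by positivity)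
  have hKge := half_le_floor hK1
  have hLle : (⌊c₂ * r ^ (-γ)⌋₊ : ℝ) ≤ c₂ * r ^ (-γ) := Nat.floor_le (by positivity)
  have hMle : (⌊1 / 16 * r ^ (-(1 - θ))⌋₊ : ℝ) ≤ 1 / 16 * r ^ (-(1 - θ)) :=
    Nat.floor_le (by positivity)
  have hKn : 1 ≤ ⌊c₁ * y⌋₊ := Nat.le_floor (by simpa using hK1)
  set K := ⌊c₁ * y⌋₊
  set L := ⌊c₂ * r ^ (-γ)⌋₊
  set M := ⌊1 / 16 * r ^ (-(1 - θ))⌋₊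
  have hK0 : (0 : ℝ) < K := by linarith [mul_pos hc₁0 hy0]
  have hyr : y ^ (-q - 1) = r := by
    rw [hy, ← Real.rpow_mul hr.le, show -(1 / (1 + q)) * (-q - 1) = 1 by field_simp; ring,
      Real.rpow_one]
  have h4K : 4 * Real.pi * K ≤ y / 4 := by
    calc 4 * Real.pi * K ≤ 4 * Real.pi * (c₁ * y) := by gcongr
      _ = y / 4 := by rw [hc₁]; field_simp; norm_num
  have h2K : y / 16 ≤ 2 * Real.pi * K := by
    calc y / 16 = 2 * Real.pi * (c₁ * y / 2) := by rw [hc₁]; field_simp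
      _ ≤ 2 * Real.pi * K := by gcongr
  have hMR : 2 * r * M ≤ r ^ θ / 8 := by
    calc 2 * r * M ≤ 2 * r * (1 / 16 * r ^ (-(1 - θ))) := by gcongr
      _ = r ^ θ / 8 := by rw [hRr]; field_simp; norm_num
  have hyp : r ^ θ ≤ y ^ (-p) := by
    rw [hy, ← Real.rpow_mul hr.le]
    refine Real.rpow_le_rpow_of_exponent_ge hr hr1.le ?_
    rw [show -(1 / (1 + q)) * -p = p / (1 + q) by ring]
    exact hθ
  have hcount : ∃ x ∈ spiral p q,
      (L : ℝ) * M ≤ sqCoverNum (ball x (r ^ θ) ∩ spiral p q) r := by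
    refine le_sqCoverNum_ball_inter_spiral hp hpq hKn ?_ hr (le_rpow_of_lt_one hθ1 hr hr1)
      ?_ ?_ hMR ?_
    · have : (L : ℝ) ≤ K := by
        calc (L : ℝ) ≤ c₂ * r ^ (-γ) := hLle
          _ ≤ c₁ / 2 * y := by gcongr
          _ ≤ K := by linarith
      exact_mod_cast this
    · have h1 : (y / 4) ^ (-q - 1) ≤ (4 * Real.pi * K) ^ (-q - 1) :=
        Real.rpow_le_rpow_of_nonpos (by positivity) h4K (by linarith)
      rw [Real.div_rpow hy0.le (by norm_num), hyr] at h1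
      have h2 : (4 : ℝ) ^ (-q - 1) ≤ 4 ^ (-1 : ℝ) :=
        Real.rpow_le_rpow_of_exponent_le (by norm_num) (by linarith)
      rw [Real.rpow_neg_one] at h2
      have h3 : 4 * r ≤ r / 4 ^ (-q - 1) := by
        rw [le_div_iff₀ (by positivity)]
        nlinarith
      linarith
    · have h1 : y ^ (-p) ≤ (4 * Real.pi * K) ^ (-p) :=
        Real.rpow_le_rpow_of_nonpos (by positivity) (by linarith) (by linarith)
      have : 0 < r ^ θ := Real.rpow_pos_of_pos hr _
      linarith
    · have h1 : (2 * Real.pi * K) ^ (-q - 1) ≤ (y / 16) ^ (-q - 1) :=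
        Real.rpow_le_rpow_of_nonpos (by positivity) h2K (by linarith)
      have h16 : (16 : ℝ) ^ (-q - 1) = (16 ^ (q + 1))⁻¹ := by
        rw [← Real.rpow_neg (by norm_num)]; ring_nf
      rw [Real.div_rpow hy0.le (by norm_num), hyr, h16, div_inv_eq_mul] at h1
      calc q * (2 * Real.pi * L) * (2 * Real.pi * K) ^ (-q - 1)
          ≤ q * (2 * Real.pi * (c₂ * (r ^ θ / r))) * (r * 16 ^ (q + 1)) := by
            have : (L : ℝ) ≤ c₂ * (r ^ θ / r) := hLle.trans (by gcongr)
            gcongr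
        _ = r ^ θ / 4 := by rw [hc₂]; field_simp; norm_num
  obtain ⟨x, hx, hxle⟩ := hcount
  refine ⟨x, hx, le_trans ?_ hxle⟩
  calc c₂ / 2 * (1 / 16 / 2) * r ^ (-(γ + (1 - θ)))
      = (c₂ * r ^ (-γ) / 2) * (1 / 16 * r ^ (-(1 - θ)) / 2) := by
        rw [neg_add, Real.rpow_add hr]; ring
    _ ≤ L * M := by
        gcongr
        · exact half_le_floor hL.le
        · exact half_le_floor hM.le

/-- The lower bound coming from turns of the spiral whose diameters are comparable to the size of
the ball. -/
lemma le_assouadSpectrum_spiral_of_thin {p q θ : ℝ} (hp : 1 ≤ p) (hpq : p ≤ q) (hθ0 : 0 ≤ θ)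
    (hθ1 : θ < 1) (hθ : θ < p / (1 + q)) :
    (1 - θ * (1 - 1 / p)) / (1 - θ) ≤ assouadSpectrum θ (spiral p q) := by
  have hpi := Real.pi_gt_three
  have hp0 : 0 < p := by linarith
  have hq1 : 1 ≤ q := hp.trans hpq
  have hq0 : 0 < 1 + q := by linarith
  set B : ℝ := 8 * Real.pi * (4 * q) with hB
  have hB1 : 1 ≤ B := by rw [hB]; nlinarith
  have hB0 : 0 < B := by linarith
  set w : ℝ := B ^ (-p) with hw
  have hw0 : 0 < w := Real.rpow_pos_of_pos hB0 _
  have hw1 : w ≤ 1 := Real.rpow_le_one_of_one_le_of_nonpos hB1 (by linarith)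
  have hδ : 0 < 1 - θ / p * (q + 1) := by
    rw [lt_div_iff₀ hq0] at hθ
    rw [sub_pos, div_mul_eq_mul_div, div_lt_one hp0]
    linarith
  refine le_assouadSpectrum (c := 4 * q * (w / 32 / 2)) hθ1 (by positivity) ?_
  filter_upwards [eventually_mem_Ioo,
    eventually_le_mul_rpow_neg 2 (Real.rpow_pos_of_pos hB0 (-q - 1)) hδ,
    eventually_le_mul_rpow_neg 1 (show 0 < w / 32 by positivity) (sub_pos.2 hθ1)]
    with r ⟨hr, hr1⟩ hgap hM
  set y : ℝ := r ^ (-(θ / p)) with hy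
  have hy1 : 1 ≤ y := Real.one_le_rpow_of_pos_of_le_one_of_nonpos hr hr1.le
    (neg_nonpos.2 (by positivity))
  have hRr : r ^ (-(1 - θ)) = r ^ θ / r := by
    rw [← Real.rpow_sub_one hr.ne']; ring_nf
  have hyp : y ^ (-p) = r ^ θ := by
    rw [hy, ← Real.rpow_mul hr.le, show -(θ / p) * -p = θ by field_simp]
  have hKge : 4 * q * y ≤ ⌈4 * q * y⌉₊ := Nat.le_ceil _
  have hq4 : 4 * 1 ≤ 4 * q * y := by nlinarith
  have hKle : (⌈4 * q * y⌉₊ : ℝ) ≤ 2 * (4 * q * y) := by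
    linarith [Nat.ceil_lt_add_one (a := 4 * q * y) (by linarith)]
  have hKn : 1 ≤ ⌈4 * q * y⌉₊ := Nat.one_le_ceil_iff.2 (by linarith)
  have hMle : (⌊w / 32 * r ^ (-(1 - θ))⌋₊ : ℝ) ≤ w / 32 * r ^ (-(1 - θ)) :=
    Nat.floor_le (by positivity)
  set K := ⌈4 * q * y⌉₊
  set M := ⌊w / 32 * r ^ (-(1 - θ))⌋₊
  have hK0 : (0 : ℝ) < K := by linarith
  have hR0 : 0 < r ^ θ := Real.rpow_pos_of_pos hr _
  have h4K : 4 * Real.pi * K ≤ B * y := by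
    calc 4 * Real.pi * K ≤ 4 * Real.pi * (2 * (4 * q * y)) := by gcongr
      _ = B * y := by rw [hB]; ring
  have hMw : 2 * r * M ≤ w * r ^ θ / 16 := by
    calc 2 * r * M ≤ 2 * r * (w / 32 * r ^ (-(1 - θ))) := by gcongr
      _ = w * r ^ θ / 16 := by rw [hRr]; field_simp; norm_num
  have hcount : ∃ x ∈ spiral p q,
      (K : ℝ) * M ≤ sqCoverNum (ball x (r ^ θ) ∩ spiral p q) r := by
    refine le_sqCoverNum_ball_inter_spiral hp hpq hKn le_rfl hr (le_rpow_of_lt_one hθ1 hr hr1)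
      ?_ ?_ ?_ ?_
    · have h1 : (B * y) ^ (-q - 1) ≤ (4 * Real.pi * K) ^ (-q - 1) :=
        Real.rpow_le_rpow_of_nonpos (by positivity) h4K (by linarith)
      have h2 : (B * y) ^ (-q - 1) = B ^ (-q - 1) * r ^ (-(1 - θ / p * (q + 1))) * r := by
        rw [Real.mul_rpow hB0.le (by linarith), hy, ← Real.rpow_mul hr.le, mul_assoc,
          ← Real.rpow_add_one hr.ne']
        congr 2
        ring
      nlinarith
    · have h1 : (B * y) ^ (-p) ≤ (4 * Real.pi * K) ^ (-p) :=
        Real.rpow_le_rpow_of_nonpos (by positivity) h4K (by linarith)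
      rw [Real.mul_rpow hB0.le (by linarith), hyp] at h1
      nlinarith [mul_pos hw0 hR0]
    · nlinarith
    · have h0 : (1 : ℝ) ≤ 2 * Real.pi * K := by nlinarith
      calc q * (2 * Real.pi * K) * (2 * Real.pi * K) ^ (-q - 1) = q * (2 * Real.pi * K) ^ (-q) := by
            rw [Real.rpow_sub_one (by positivity)]; field_simp
        _ ≤ q * (2 * Real.pi * K) ^ (-p) := by
            gcongr q * ?_
            exact Real.rpow_le_rpow_of_exponent_le h0 (by linarith)
        _ ≤ q * (4 * q * y) ^ (-p) := by
            gcongr q * ?_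
            exact Real.rpow_le_rpow_of_nonpos (by linarith) (by nlinarith) (by linarith)
        _ = q * ((4 * q) ^ (-p) * r ^ θ) := by
            rw [Real.mul_rpow (by linarith) (by linarith), hyp]
        _ ≤ q * ((4 * q) ^ (-1 : ℝ) * r ^ θ) := by
            gcongr q * (?_ * _)
            exact Real.rpow_le_rpow_of_exponent_le (by linarith) (by linarith)
        _ = r ^ θ / 4 := by
            rw [Real.rpow_neg_one]; field_simp
  obtain ⟨x, hx, hxle⟩ := hcount
  refine ⟨x, hx, le_trans ?_ hxle⟩
  calc 4 * q * (w / 32 / 2) * r ^ (-(1 - θ * (1 - 1 / p)))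
      = (4 * q * y) * (w / 32 * r ^ (-(1 - θ)) / 2) := by
        rw [show -(1 - θ * (1 - 1 / p)) = -(θ / p) + -(1 - θ) by ring, Real.rpow_add hr]
        ring
    _ ≤ K * M := by
        gcongr
        exact half_le_floor hM.le

theorem assouadSpectrum_spiral_of_one_le (p q θ : ℝ) (hp : 1 ≤ p) (hpq : p ≤ q)
    (hθ0 : 0 ≤ θ) (hθ1 : θ < 1) :
    assouadSpectrum θ (spiral p q) =
      if θ < p / (1 + q) then (p - θ * (p - 1)) / (p * (1 - θ))
      else if θ < q / (1 + q) then (2 + q - θ * (1 + q)) / ((1 + q) * (1 - θ))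
      else 2 := by
  have hp0 : 0 < p := by linarith
  have hq0 : 0 < 1 + q := by linarith
  have hθ' : 0 < 1 - θ := by linarith
  split_ifs with h1 h2
  · have hval : (p - θ * (p - 1)) / (p * (1 - θ)) = (1 - θ * (1 - 1 / p)) / (1 - θ) := by
      field_simp
    rw [hval]
    refine le_antisymm (le_of_forall_gt_imp_ge_of_dense fun α hα => ?_)
      (le_assouadSpectrum_spiral_of_thin hp hpq hθ0 hθ1 h1)
    have hα0 : 0 ≤ α := by
      refine le_trans (div_nonneg ?_ hθ'.le) hα.le
      have : 0 < 1 / p := by positivity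
      nlinarith
    rw [div_lt_iff₀' hθ'] at hα
    obtain ⟨C, hC, h⟩ := exists_sqCoverNum_spiral_le_of_thin hp hpq h1 hα
    exact assouadSpectrum_le hα0 hC fun r hr hr1 x _ => h r hr hr1 x
  · refine le_antisymm (assouadSpectrum_le ?_ (by norm_num : (0 : ℝ) < 58)
      fun r hr hr1 x _ => sqCoverNum_spiral_le_of_thick hp hpq hθ1 hr hr1 x) ?_
    · exact div_nonneg (by nlinarith) (by positivity)
    · have hval : (2 + q - θ * (1 + q)) / ((1 + q) * (1 - θ)) =
          (1 / (1 + q) + (1 - θ)) / (1 - θ) := by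
        field_simp
        ring
      rw [hval]
      refine le_assouadSpectrum_spiral_of_thick hp hpq hθ1 (not_lt.1 h1) (by positivity) ?_ le_rfl
      have : 1 / (1 + q) + q / (1 + q) = 1 := by field_simp
      linarith
  · obtain ⟨h0, C, hC, h⟩ := two_mem_assouadSpectrum_exponents hθ1 (spiral p q)
    refine le_antisymm (assouadSpectrum_le h0 hC h) ?_
    have := le_assouadSpectrum_spiral_of_thick (γ := 1 - θ) hp hpq hθ1 (not_lt.1 h1) hθ' le_rfl ?_
    · rwa [← two_mul, mul_div_assoc, div_self hθ'.ne', mul_one] at this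
    · have : 1 / (1 + q) + q / (1 + q) = 1 := by field_simp
      linarith
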